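/- Assume in addition that q is a nonzero real number, that β is real-valued on 𝒟, and that v satisfies the bottom conditions v(r,s(r)) = 0 and v_r(r,s(r)) = 0 for all r ∈ [0,R]. Then the solution is L²-conservative: ∫₀^{s(r)} |v(r,z)|² dz = ∫₀^{s(0)} |v(0,z)|² dz for every r ∈ [0,R]. -/

import Mathlib

open Complex Set MeasureTheory intervalIntegral

/-- Partial derivative in the first (range) variable. -/
noncomputable def pr (f : ℝ → ℝ → ℂ) (r z : ℝ) : ℂ := deriv (fun t => f t z) r

/-- Partial derivative in the second (depth) variable. -/
noncomputable def pz (f : ℝ → ℝ → ℂ) (r z : ℝ) : ℂ := deriv (fun w => f r w) z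

/-- The waveguide domain `𝒟 = {(r,z) : 0 ≤ r ≤ R, 0 ≤ z ≤ s(r)}`. -/
def wgDom (R : ℝ) (s : ℝ → ℝ) : Set (ℝ × ℝ) :=
  {p : ℝ × ℝ | p.1 ∈ Icc 0 R ∧ p.2 ∈ Icc 0 (s p.1)}

/-- Smoothness on an open neighborhood of the domain `𝒟`. -/
def SmoothNearDom (R : ℝ) (s : ℝ → ℝ) (f : ℝ → ℝ → ℂ) : Prop :=
  ∃ U : Set (ℝ × ℝ), IsOpen U ∧ wgDom R s ⊆ U ∧
    ContDiffOn ℝ (⊤ : ℕ∞) (fun p : ℝ × ℝ => f p.1 p.2) U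

section PartialDerivatives

variable {E : Type*} [NormedAddCommGroup E] [NormedSpace ℝ E]

lemma hasDerivAt_left_of_differentiableAt {f : ℝ × ℝ → E} {r z : ℝ}
    (hf : DifferentiableAt ℝ f (r, z)) :
    HasDerivAt (fun t => f (t, z)) (fderiv ℝ f (r, z) (1, 0)) r :=
  hf.hasFDerivAt.comp_hasDerivAt r ((hasDerivAt_id r).prodMk (hasDerivAt_const r z))

lemma hasDerivAt_right_of_differentiableAt {f : ℝ × ℝ → E} {r z : ℝ}
    (hf : DifferentiableAt ℝ f (r, z)) :
    HasDerivAt (fun y => f (r, y)) (fderiv ℝ f (r, z) (0, 1)) z :=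
  hf.hasFDerivAt.comp_hasDerivAt z ((hasDerivAt_const z r).prodMk (hasDerivAt_id z))

end PartialDerivatives

/-- If `∂ₜ g = ∂_x K` on the rectangle `[a, b] × [0, 1]` and `K` has equal values at both ends
`x = 0` and `x = 1`, then `∫₀¹ g(b, x) dx = ∫₀¹ g(a, x) dx`. -/
lemma integral_eq_of_hasDerivAt_flux {a b : ℝ} (hab : a ≤ b) {g g' K : ℝ → ℝ → ℝ}
    (hg : ∀ t ∈ Icc a b, ContinuousOn (g t) (Icc 0 1))
    (hg' : ContinuousOn (fun p : ℝ × ℝ => g' p.1 p.2) (Icc a b ×ˢ Icc 0 1))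
    (hgt : ∀ t ∈ Icc a b, ∀ x ∈ Icc (0 : ℝ) 1, HasDerivAt (fun u => g u x) (g' t x) t)
    (hK : ∀ t ∈ Icc a b, ∀ x ∈ Icc (0 : ℝ) 1, HasDerivAt (K t) (g' t x) x)
    (hK01 : ∀ t ∈ Icc a b, K t 1 = K t 0) :
    ∫ x in (0 : ℝ)..1, g b x = ∫ x in (0 : ℝ)..1, g a x := by
  have h01 : (0 : ℝ) ≤ 1 := zero_le_one
  have hcx : ∀ t ∈ Icc a b, ContinuousOn (g' t) (Icc 0 1) := fun t ht =>
    hg'.comp (f := fun x => (t, x)) (by fun_prop) fun x hx => ⟨ht, hx⟩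
  have hct : ∀ x ∈ Icc (0 : ℝ) 1, ContinuousOn (fun t => g' t x) (Icc a b) := fun x hx =>
    hg'.comp (f := fun t => (t, x)) (by fun_prop) fun t ht => ⟨ht, hx⟩
  have hga : IntervalIntegrable (g a) volume 0 1 := by
    apply ContinuousOn.intervalIntegrable
    rw [uIcc_of_le h01]; exact hg a (left_mem_Icc.2 hab)
  have hgb : IntervalIntegrable (g b) volume 0 1 := by
    apply ContinuousOn.intervalIntegrable
    rw [uIcc_of_le h01]; exact hg b (right_mem_Icc.2 hab)
  have hint : IntegrableOn (Function.uncurry g') (uIoc a b ×ˢ uIoc 0 1) := by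
    rw [uIoc_of_le hab, uIoc_of_le h01]
    exact (hg'.integrableOn_compact (isCompact_Icc.prod isCompact_Icc)).mono_set
      (prod_mono Ioc_subset_Icc_self Ioc_subset_Icc_self)
  rw [← sub_eq_zero, ← integral_sub hgb hga]
  calc ∫ x in (0 : ℝ)..1, (g b x - g a x)
      = ∫ x in (0 : ℝ)..1, ∫ t in a..b, g' t x := by
        refine integral_congr fun x hx => ?_
        rw [uIcc_of_le h01] at hx
        refine (integral_eq_sub_of_hasDerivAt (f := fun u => g u x) (fun t ht => ?_) ?_).symm
        · rw [uIcc_of_le hab] at ht; exact hgt t ht x hx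
        · apply ContinuousOn.intervalIntegrable
          rw [uIcc_of_le hab]; exact hct x hx
    _ = ∫ t in a..b, ∫ x in (0 : ℝ)..1, g' t x := (intervalIntegral_intervalIntegral_swap hint).symm
    _ = ∫ t in a..b, (0 : ℝ) := by
        refine integral_congr fun t ht => ?_
        rw [uIcc_of_le hab] at ht
        rw [integral_eq_sub_of_hasDerivAt (f := K t), hK01 t ht, sub_self]
        · intro x hx; rw [uIcc_of_le h01] at hx; exact hK t ht x hx
        · apply ContinuousOn.intervalIntegrable
          rw [uIcc_of_le h01]; exact hcx t ht
    _ = 0 := by simp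

/-- A conservation law `∂_r ρ = ∂_z J` on a domain with moving boundary `z = s(r)`: if `J` vanishes
at `z = 0` and `z = s(r)` and `ρ` vanishes at `z = s(r)`, then the total mass is constant. -/
lemma integral_eq_of_conservation_law {R : ℝ} {s : ℝ → ℝ} (hs : ContDiff ℝ 1 s)
    (hspos : ∀ r ∈ Icc (0 : ℝ) R, 0 < s r) {U : Set (ℝ × ℝ)} (hU : IsOpen U)
    (hDU : wgDom R s ⊆ U) {ρ J : ℝ × ℝ → ℝ} (hρ : ContDiffOn ℝ 1 ρ U) (hJ : ContDiffOn ℝ 1 J U)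
    (hcons : ∀ p ∈ wgDom R s, fderiv ℝ ρ p (1, 0) = fderiv ℝ J p (0, 1))
    (hJ0 : ∀ r ∈ Icc (0 : ℝ) R, J (r, 0) = 0) (hJs : ∀ r ∈ Icc (0 : ℝ) R, J (r, s r) = 0)
    (hρs : ∀ r ∈ Icc (0 : ℝ) R, ρ (r, s r) = 0) {r : ℝ} (hr : r ∈ Icc (0 : ℝ) R) :
    ∫ z in (0 : ℝ)..(s r), ρ (r, z) = ∫ z in (0 : ℝ)..(s 0), ρ (0, z) := by
  have hscale : ∀ t, ∫ z in (0 : ℝ)..(s t), ρ (t, z)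
      = ∫ x in (0 : ℝ)..1, s t * ρ (t, s t * x) := fun t => by
    rw [intervalIntegral.integral_const_mul, mul_integral_comp_mul_left (f := fun z => ρ (t, z))]
    simp
  have hmem : ∀ t ∈ Icc (0 : ℝ) r, ∀ x ∈ Icc (0 : ℝ) 1, (t, s t * x) ∈ wgDom R s := by
    intro t ht x hx
    have htR : t ∈ Icc (0 : ℝ) R := ⟨ht.1, ht.2.trans hr.2⟩
    have := hspos t htR
    exact ⟨htR, by have := hx.1; positivity, mul_le_of_le_one_right this.le hx.2⟩
  have hmaps : MapsTo (fun p : ℝ × ℝ => (p.1, s p.1 * p.2)) (Icc 0 r ×ˢ Icc 0 1) U :=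
    fun p hp => hDU (hmem p.1 hp.1 p.2 hp.2)
  have hsc : Continuous s := hs.continuous
  have hs'c : Continuous (deriv s) := hs.continuous_deriv le_rfl
  have hsd : ∀ t, HasDerivAt s (deriv s t) t := fun t =>
    (hs.differentiable one_ne_zero t).hasDerivAt
  have hdiff : ∀ {f : ℝ × ℝ → ℝ}, ContDiffOn ℝ 1 f U → ∀ p ∈ U, DifferentiableAt ℝ f p :=
    fun hf p hp => (hf.differentiableOn one_ne_zero).differentiableAt (hU.mem_nhds hp)
  rw [hscale, hscale]
  refine integral_eq_of_hasDerivAt_flux (g := fun t x => s t * ρ (t, s t * x))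
    (g' := fun t x => deriv s t * ρ (t, s t * x)
      + s t * fderiv ℝ ρ (t, s t * x) (1, deriv s t * x))
    (K := fun t x => J (t, s t * x) + deriv s t * (x * ρ (t, s t * x)))
    hr.1 ?_ ?_ ?_ ?_ ?_
  · intro t ht
    exact continuousOn_const.mul (hρ.continuousOn.comp (f := fun x => (t, s t * x))
      (by fun_prop) fun x hx => hDU (hmem t ht x hx))
  · have h1 := hρ.continuousOn.comp (by fun_prop) hmaps
    have h2 := (hρ.continuousOn_fderiv_of_isOpen hU le_rfl).comp (by fun_prop) hmaps
    refine ContinuousOn.add (ContinuousOn.mul (by fun_prop) h1)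
      (ContinuousOn.mul (by fun_prop) (h2.clm_apply (by fun_prop)))
  · intro t ht x hx
    have h := (hdiff hρ _ (hDU (hmem t ht x hx))).hasFDerivAt.comp_hasDerivAt t
      ((hasDerivAt_id t).prodMk ((hsd t).mul_const x))
    exact (hsd t).mul h
  · intro t ht x hx
    have hp := hmem t ht x hx
    have hl : HasDerivAt (fun y => s t * y) (s t) x := by
      simpa using (hasDerivAt_id x).const_mul (s t)
    have h1 := (hasDerivAt_right_of_differentiableAt (hdiff hJ _ (hDU hp))).comp x hl
    have h2 := (hasDerivAt_right_of_differentiableAt (hdiff hρ _ (hDU hp))).comp x hl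
    refine (h1.add (((hasDerivAt_id x).mul h2).const_mul (deriv s t))).congr_deriv ?_
    have hdir : ((1 : ℝ), deriv s t * x) = (1, 0) + (deriv s t * x) • ((0 : ℝ), (1 : ℝ)) := by
      simp
    rw [hdir, map_add, map_smul, hcons _ hp]
    simp
    ring
  · intro t ht
    have htR : t ∈ Icc (0 : ℝ) R := ⟨ht.1, ht.2.trans hr.2⟩
    simp [hJ0 t htR, hJs t htR, hρs t htR]

section Smooth

variable {U : Set (ℝ × ℝ)} {f : ℝ → ℝ → ℂ}

lemma hasDerivAt_pr (hU : IsOpen U) (hf : ContDiffOn ℝ (⊤ : ℕ∞) (fun p : ℝ × ℝ => f p.1 p.2) U)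
    {r z : ℝ} (hp : (r, z) ∈ U) : HasDerivAt (fun t => f t z) (pr f r z) r :=
  (hasDerivAt_left_of_differentiableAt ((hf.differentiableOn (by simp)).differentiableAt
    (hU.mem_nhds hp))).differentiableAt.hasDerivAt

lemma hasDerivAt_pz (hU : IsOpen U) (hf : ContDiffOn ℝ (⊤ : ℕ∞) (fun p : ℝ × ℝ => f p.1 p.2) U)
    {r z : ℝ} (hp : (r, z) ∈ U) : HasDerivAt (fun y => f r y) (pz f r z) z :=
  (hasDerivAt_right_of_differentiableAt ((hf.differentiableOn (by simp)).differentiableAt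
    (hU.mem_nhds hp))).differentiableAt.hasDerivAt

lemma pr_eq_fderiv (hU : IsOpen U) (hf : ContDiffOn ℝ (⊤ : ℕ∞) (fun p : ℝ × ℝ => f p.1 p.2) U)
    {p : ℝ × ℝ} (hp : p ∈ U) :
    pr f p.1 p.2 = fderiv ℝ (fun p : ℝ × ℝ => f p.1 p.2) p (1, 0) :=
  (hasDerivAt_left_of_differentiableAt ((hf.differentiableOn (by simp)).differentiableAt
    (hU.mem_nhds hp))).deriv

lemma pz_eq_fderiv (hU : IsOpen U) (hf : ContDiffOn ℝ (⊤ : ℕ∞) (fun p : ℝ × ℝ => f p.1 p.2) U)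
    {p : ℝ × ℝ} (hp : p ∈ U) :
    pz f p.1 p.2 = fderiv ℝ (fun p : ℝ × ℝ => f p.1 p.2) p (0, 1) :=
  (hasDerivAt_right_of_differentiableAt ((hf.differentiableOn (by simp)).differentiableAt
    (hU.mem_nhds hp))).deriv

lemma ContDiffOn.pr (hU : IsOpen U)
    (hf : ContDiffOn ℝ (⊤ : ℕ∞) (fun p : ℝ × ℝ => f p.1 p.2) U) :
    ContDiffOn ℝ (⊤ : ℕ∞) (fun p : ℝ × ℝ => pr f p.1 p.2) U :=
  ((hf.fderiv_of_isOpen hU (m := (⊤ : ℕ∞)) (by simp)).clm_apply contDiffOn_const).congr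
    fun _ hp => pr_eq_fderiv hU hf hp

lemma ContDiffOn.pz (hU : IsOpen U)
    (hf : ContDiffOn ℝ (⊤ : ℕ∞) (fun p : ℝ × ℝ => f p.1 p.2) U) :
    ContDiffOn ℝ (⊤ : ℕ∞) (fun p : ℝ × ℝ => pz f p.1 p.2) U :=
  ((hf.fderiv_of_isOpen hU (m := (⊤ : ℕ∞)) (by simp)).clm_apply contDiffOn_const).congr
    fun _ hp => pz_eq_fderiv hU hf hp

lemma pr_pz_comm (hU : IsOpen U) (hf : ContDiffOn ℝ (⊤ : ℕ∞) (fun p : ℝ × ℝ => f p.1 p.2) U)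
    {p : ℝ × ℝ} (hp : p ∈ U) : pr (pz f) p.1 p.2 = pz (pr f) p.1 p.2 := by
  set F : ℝ × ℝ → ℂ := fun p => f p.1 p.2
  have hd : DifferentiableAt ℝ (fderiv ℝ F) p :=
    ((hf.fderiv_of_isOpen hU (m := (⊤ : ℕ∞)) (by simp)).differentiableOn (by simp)).differentiableAt
      (hU.mem_nhds hp)
  have hsymm : IsSymmSndFDerivAt ℝ F p :=
    (hf.contDiffAt (hU.mem_nhds hp)).isSymmSndFDerivAt (by
      simpa using WithTop.coe_le_coe.2 (le_top : (2 : ℕ∞) ≤ ⊤))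
  have happ : ∀ a b : ℝ × ℝ,
      fderiv ℝ (fun x => fderiv ℝ F x a) p b = fderiv ℝ (fderiv ℝ F) p b a := fun a b => by
    rw [fderiv_clm_apply hd (differentiableAt_const a)]
    simp
  have hz : (fun x : ℝ × ℝ => pz f x.1 x.2) =ᶠ[nhds p] fun x => fderiv ℝ F x (0, 1) :=
    Filter.eventually_of_mem (hU.mem_nhds hp) fun x hx => pz_eq_fderiv hU hf hx
  have hr : (fun x : ℝ × ℝ => pr f x.1 x.2) =ᶠ[nhds p] fun x => fderiv ℝ F x (1, 0) :=
    Filter.eventually_of_mem (hU.mem_nhds hp) fun x hx => pr_eq_fderiv hU hf hx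
  rw [pr_eq_fderiv hU (hf.pz hU) hp, pz_eq_fderiv hU (hf.pr hU) hp, hz.fderiv_eq, hr.fderiv_eq,
    happ, happ, hsymm.eq]

lemma pz_congr {g : ℝ → ℝ → ℂ} (hU : IsOpen U) (h : ∀ p ∈ U, f p.1 p.2 = g p.1 p.2) {p : ℝ × ℝ}
    (hp : p ∈ U) : pz f p.1 p.2 = pz g p.1 p.2 := by
  refine Filter.EventuallyEq.deriv_eq ?_
  have : (fun w => (p.1, w)) ⁻¹' U ∈ nhds p.2 :=
    (hU.preimage (by fun_prop)).mem_nhds hp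
  exact Filter.eventually_of_mem this fun w hw => h _ hw

lemma pr_pz_pz (hU : IsOpen U) (hf : ContDiffOn ℝ (⊤ : ℕ∞) (fun p : ℝ × ℝ => f p.1 p.2) U)
    {p : ℝ × ℝ} (hp : p ∈ U) : pr (pz (pz f)) p.1 p.2 = pz (pz (pr f)) p.1 p.2 := by
  rw [pr_pz_comm hU (hf.pz hU) hp]
  exact pz_congr hU (fun x hx => pr_pz_comm hU hf hx) hp

end Smooth

/-- If `a + qβa + α²qA = iλ(α²B + βu)` with real `q` and `β`, then the flux of `w = qa - iλu`,
whose second depth derivative is `qA - iλB`, controls `Re(a ū)`. -/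
lemma re_mul_conj_eq_flux {α lam : ℝ} (hlam : lam ≠ 0) {q b a u A B : ℂ} (hq : q.im = 0)
    (hb : b.im = 0)
    (h : (1 + q * b) * a + (α : ℂ) ^ 2 * q * A
      = Complex.I * (lam : ℂ) * ((α : ℂ) ^ 2 * B + b * u)) :
    2 * (a.re * u.re + a.im * u.im) = -2 * α ^ 2 / lam *
      ((q * A - Complex.I * lam * B) * (starRingEnd ℂ) (q * a - Complex.I * lam * u)).im := by
  obtain ⟨q, rfl⟩ : ∃ x : ℝ, (x : ℂ) = q := ⟨q.re, Complex.ext rfl (by simp [hq])⟩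
  obtain ⟨b, rfl⟩ : ∃ x : ℝ, (x : ℂ) = b := ⟨b.re, Complex.ext rfl (by simp [hb])⟩
  have key : (α : ℂ) ^ 2 * (q * A - Complex.I * lam * B)
      = -(a + b * (q * a - Complex.I * lam * u)) := by linear_combination h
  have him : α ^ 2 *
      ((q * A - Complex.I * lam * B) * (starRingEnd ℂ) (q * a - Complex.I * lam * u)).im
      = -(lam * (a.re * u.re + a.im * u.im)) := by
    rw [← Complex.im_ofReal_mul, ← mul_assoc, Complex.ofReal_pow, key]
    simp
    ring
  rw [div_mul_eq_mul_div, mul_assoc, him]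
  field_simp

/-- `L²`-conservation: if moreover `q` is a nonzero real, `β` is real-valued on
`𝒟`, and `v(r,s(r)) = 0`, `v_r(r,s(r)) = 0` for all `r ∈ [0,R]`, then
`∫₀^{s(r)} |v(r,z)|² dz = ∫₀^{s(0)} |v(0,z)|² dz` for every `r ∈ [0,R]`. -/
theorem stmt_4 (R α : ℝ) (q : ℂ) (lam : ℝ) (s : ℝ → ℝ) (β v : ℝ → ℝ → ℂ)
    (hR : 0 < R) (hα : 0 < α) (hq : q ≠ 0) (hlam : lam ≠ 0)
    (hs : ContDiff ℝ 1 s) (hspos : ∀ r ∈ Icc (0:ℝ) R, 0 < s r)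
    (hβ : SmoothNearDom R s β) (hv : SmoothNearDom R s v)
    (hpde : ∀ r ∈ Icc (0:ℝ) R, ∀ z ∈ Icc (0:ℝ) (s r),
      (1 + q * β r z) * pr v r z + (α : ℂ) ^ 2 * q * pr (pz (pz v)) r z
        = Complex.I * (lam : ℂ) * ((α : ℂ) ^ 2 * pz (pz v) r z + β r z * v r z))
    (hsurf : ∀ r ∈ Icc (0:ℝ) R, v r 0 = 0)
    (hqreal : q.im = 0)
    (hβreal : ∀ r ∈ Icc (0:ℝ) R, ∀ z ∈ Icc (0:ℝ) (s r), (β r z).im = 0)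
    (hbot : ∀ r ∈ Icc (0:ℝ) R, v r (s r) = 0)
    (hbot' : ∀ r ∈ Icc (0:ℝ) R, pr v r (s r) = 0) :
    ∀ r ∈ Icc (0:ℝ) R,
      (∫ z in (0:ℝ)..(s r), ‖v r z‖ ^ 2) = ∫ z in (0:ℝ)..(s 0), ‖v 0 z‖ ^ 2 := by
  intro r hr
  obtain ⟨U, hU, hDU, hv⟩ := hv
  have hvr := hv.pr hU
  have hvz := hv.pz hU
  have hvrz := hvr.pz hU
  have hsurf' : ∀ r ∈ Icc (0 : ℝ) R, pr v r 0 = 0 := fun r hr => by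
    have hp : (r, (0 : ℝ)) ∈ wgDom R s := ⟨hr, le_rfl, (hspos r hr).le⟩
    have hd := (hasDerivAt_pr hU hv (hDU hp)).hasDerivWithinAt (s := Icc 0 R)
    exact (uniqueDiffOn_Icc hR r hr).eq_deriv _ hd
      ((hasDerivWithinAt_const r (Icc 0 R) (0 : ℂ)).congr hsurf (hsurf r hr))
  let w : ℝ × ℝ → ℂ := fun p => q * pr v p.1 p.2 - Complex.I * lam * v p.1 p.2
  let wz : ℝ × ℝ → ℂ := fun p => q * pz (pr v) p.1 p.2 - Complex.I * lam * pz v p.1 p.2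
  have hw : ContDiffOn ℝ 1 w U :=
    ((contDiffOn_const.mul hvr).sub (contDiffOn_const.mul hv)).of_le (by simp)
  have hwz : ContDiffOn ℝ 1 wz U :=
    ((contDiffOn_const.mul hvrz).sub (contDiffOn_const.mul hvz)).of_le (by simp)
  let J : ℝ × ℝ → ℝ := fun p => -2 * α ^ 2 / lam * (wz p * (starRingEnd ℂ) (w p)).im
  have hconjw : ContDiffOn ℝ 1 (fun p => (starRingEnd ℂ) (w p)) U :=
    Complex.conjCLE.contDiff.comp_contDiffOn hw
  have hJ : ContDiffOn ℝ 1 J U :=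
    contDiffOn_const.mul (Complex.imCLM.contDiff.comp_contDiffOn (hwz.mul hconjw))
  have hρ : ContDiffOn ℝ 1 (fun p : ℝ × ℝ => ‖v p.1 p.2‖ ^ 2) U :=
    (hv.of_le (by simp)).norm_sq ℝ
  refine integral_eq_of_conservation_law (ρ := fun p : ℝ × ℝ => ‖v p.1 p.2‖ ^ 2) (J := J)
    hs hspos hU hDU hρ hJ ?_ ?_ ?_ ?_ hr
  · rintro ⟨r, z⟩ hp
    have hpU := hDU hp
    have hdiff : ∀ {f : ℝ × ℝ → ℝ}, ContDiffOn ℝ 1 f U → DifferentiableAt ℝ f (r, z) :=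
      fun hf => (hf.differentiableOn one_ne_zero).differentiableAt (hU.mem_nhds hpU)
    have hdw : HasDerivAt (fun y => w (r, y)) (wz (r, z)) z :=
      ((hasDerivAt_pz hU hvr hpU).const_mul q).sub
        ((hasDerivAt_pz hU hv hpU).const_mul (Complex.I * lam))
    have hdwz : HasDerivAt (fun y => wz (r, y))
        (q * pz (pz (pr v)) r z - Complex.I * lam * pz (pz v) r z) z :=
      ((hasDerivAt_pz hU hvrz hpU).const_mul q).sub
        ((hasDerivAt_pz hU hvz hpU).const_mul (Complex.I * lam))
    have hdconj : HasDerivAt (fun y => (starRingEnd ℂ) (w (r, y))) ((starRingEnd ℂ) (wz (r, z))) z :=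
      Complex.conjCLE.hasFDerivAt.comp_hasDerivAt z hdw
    have hdJ := (Complex.imCLM.hasFDerivAt.comp_hasDerivAt z (hdwz.mul hdconj)).const_mul
      (-2 * α ^ 2 / lam)
    have hdρ := (hasDerivAt_pr hU hv hpU).norm_sq
    rw [(hasDerivAt_left_of_differentiableAt (hdiff hρ)).unique hdρ,
      (hasDerivAt_right_of_differentiableAt (hdiff hJ)).unique hdJ]
    have hpde' := hpde r hp.1 z hp.2
    rw [pr_pz_pz hU hv hpU] at hpde'
    have hflux := re_mul_conj_eq_flux hlam hqreal (hβreal r hp.1 z hp.2) hpde'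
    rw [map_add, Complex.imCLM_apply, Complex.imCLM_apply, Complex.mul_conj, Complex.ofReal_im,
      add_zero, ← hflux, Complex.inner]
    simp [Complex.mul_re]
  · intro t ht
    simp [J, w, hsurf t ht, hsurf' t ht]
  · intro t ht
    simp [J, w, hbot t ht, hbot' t ht]
  · intro t ht
    simp [hbot t ht]
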